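/- Let s ≥ 2, s' ∈ {s, s+1}, and let H be a coloured (s',s)-butterfly with centres (c1,c2) (an (s',s)-butterfly with u0 = c1 and u1 = c2 in the notation below, all of whose edges are coloured red or blue) such that: the five edges of the central path u4u2c1c2u3u5 are red, each wing contains at least two red edges, the c1-wing contains exactly one or two blue edges, the c2-wing contains at most as many blue edges as the c1-wing, and if each wing contains two blue edges then s' = s. Then Builder has a winning strategy in RR(C4, P_{v(H)}, H), where v(H) = 6 + s' + s is the number of vertices of H. -/

import Mathlib

/-!
The game `RR(C₄, Pₙ, H)`: the board is `K_ℕ` on which a coloured graph `H`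
(with red edge set `R₀` and blue edge set `B₀`) is initially placed.  In each
round Builder selects a previously uncoloured edge and Painter colours it red
(`true`) or blue (`false`), except that Painter may never colour an edge red
if the red edges would then contain a `C₄`.  Builder wins if `e(H) ≤ 2n - 2`
and after at most `2n - 2 - e(H)` rounds the blue edges number exactly `n - 1`
and contain a path on `n` vertices.
-/

namespace OnlineRamsey

abbrev Edge := Sym2 ℕ
abbrev History := List (Edge × Bool)   -- `true` = red, `false` = blue
abbrev BuilderStrat := History → Edge
abbrev PainterStrat := History → Edge → Bool

/-- The history of coloured edges after `t` rounds (not counting the initial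
coloured graph), when Builder follows `B` and Painter follows `P`. -/
def gamePlay (B : BuilderStrat) (P : PainterStrat) : ℕ → History
  | 0 => []
  | t + 1 =>
      let h := gamePlay B P t
      h ++ [(B h, P h (B h))]

/-- All red edges: the initially placed ones together with those coloured red. -/
def redSet (R₀ : Set Edge) (h : History) : Set Edge := R₀ ∪ {e | (e, true) ∈ h}

/-- All blue edges: the initially placed ones together with those coloured blue. -/
def blueSet (B₀ : Set Edge) (h : History) : Set Edge := B₀ ∪ {e | (e, false) ∈ h}

/-- `H` contains a copy of `G`. -/
def HasCopy {α β : Type} (G : SimpleGraph α) (H : SimpleGraph β) : Prop :=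
  ∃ f : G →g H, Function.Injective f

/-- Painter never colours an edge red if the red edges would then contain a `C₄`. -/
def PainterLegal (R₀ : Set Edge) (P : PainterStrat) : Prop :=
  ∀ (h : History) (e : Edge), P h e = true →
    ¬ HasCopy (SimpleGraph.cycleGraph 4)
        (SimpleGraph.fromEdgeSet (insert e (redSet R₀ h)))

/-- During the first `m` rounds Builder always selects a previously uncoloured
(non-loop) edge. -/
def BuilderLegal (R₀ B₀ : Set Edge) (B : BuilderStrat) (m : ℕ) : Prop :=
  ∀ P : PainterStrat, ∀ t < m,
    ¬ (B (gamePlay B P t)).IsDiag ∧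
      B (gamePlay B P t) ∉ redSet R₀ (gamePlay B P t) ∪ blueSet B₀ (gamePlay B P t)

/-- Builder has a winning strategy in the game `RR(C₄, Pₙ, H)`, where the initial
coloured graph `H` has red edge set `R₀` and blue edge set `B₀`. -/
def RRWin (n : ℕ) (R₀ B₀ : Set Edge) : Prop :=
  (R₀ ∪ B₀).ncard ≤ 2 * n - 2 ∧
  ∃ B : BuilderStrat, BuilderLegal R₀ B₀ B (2 * n - 2 - (R₀ ∪ B₀).ncard) ∧
    ∀ P : PainterStrat, PainterLegal R₀ P →
      ∃ t ≤ 2 * n - 2 - (R₀ ∪ B₀).ncard,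
        (blueSet B₀ (gamePlay B P t)).ncard = n - 1 ∧
        HasCopy (SimpleGraph.pathGraph n)
          (SimpleGraph.fromEdgeSet (blueSet B₀ (gamePlay B P t)))

/-!
The `(p, q)`-butterfly with centres `(c₁, c₂) = (0, 1)`, realised on `ℕ` with
`u₂ = 2`, `u₃ = 3`, `u₄ = 4`, `u₅ = 5`, `c₁`-wing vertices `xᵢ = 5 + i`
(`1 ≤ i ≤ p`) and `c₂`-wing vertices `yⱼ = 5 + p + j` (`1 ≤ j ≤ q`); it has
`v(H) = 6 + p + q` vertices.
-/

/-- The five edges of the central path `u₄u₂c₁c₂u₃u₅`. -/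
def centralPathEdges : Set Edge := {s(4, 2), s(2, 0), s(0, 1), s(1, 3), s(3, 5)}

/-- The edges of the `c₁`-wing (centre `c₁ = 0`, wing size `p`). -/
def wing1 (p : ℕ) : Set Edge := {e | ∃ i : ℕ, 1 ≤ i ∧ i ≤ p ∧ e = s(0, 5 + i)}

/-- The edges of the `c₂`-wing (centre `c₂ = 1`, wing size `q`). -/
def wing2 (p q : ℕ) : Set Edge := {e | ∃ j : ℕ, 1 ≤ j ∧ j ≤ q ∧ e = s(1, 5 + p + j)}

/-- The red graph contains no four-cycle. -/
def C4Free (S : Set Edge) : Prop :=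
  ¬ HasCopy (SimpleGraph.cycleGraph 4) (SimpleGraph.fromEdgeSet S)

lemma has_c4_of_path {R : Set Edge} {a u v b : ℕ} (h1 : s(a, u) ∈ R) (h2 : s(u, v) ∈ R)
    (h3 : s(v, b) ∈ R) (hau : a ≠ u) (hav : a ≠ v) (hab : a ≠ b) (huv : u ≠ v) (hub : u ≠ b)
    (hvb : v ≠ b) : ¬ C4Free (insert s(a, b) R) := by
  unfold C4Free HasCopy
  rw [not_not]
  have h4 : s(b, a) = s(a, b) := Sym2.eq_swap
  have h1' : s(u, a) ∈ R := by rwa [Sym2.eq_swap]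
  have h2' : s(v, u) ∈ R := by rwa [Sym2.eq_swap]
  have h3' : s(b, v) ∈ R := by rwa [Sym2.eq_swap]
  refine ⟨⟨![a, u, v, b], ?_⟩, ?_⟩
  · intro i j hij
    rw [SimpleGraph.cycleGraph_adj] at hij
    fin_cases i <;> fin_cases j <;>
      first
        | (exfalso; revert hij; decide)
        | simp_all [SimpleGraph.fromEdgeSet_adj, eq_comm]
  · intro i j hij
    fin_cases i <;> fin_cases j <;> simp_all [eq_comm]

/-- A set of edges in which every vertex has at most one smaller neighbour has no four-cycle. -/
lemma c4Free_of_parent {R : Set Edge} (par : ℕ → ℕ)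
    (h : ∀ a b : ℕ, a < b → s(a, b) ∈ R → a = par b) : C4Free R := by
  rintro ⟨f, hf⟩
  have adj : ∀ i j : Fin 4, (SimpleGraph.cycleGraph 4).Adj i j → s(f i, f j) ∈ R := by
    intro i j hij
    have := f.map_adj hij
    rw [SimpleGraph.fromEdgeSet_adj] at this
    exact this.1
  have key : ∀ i j k : Fin 4, (SimpleGraph.cycleGraph 4).Adj i j →
      (SimpleGraph.cycleGraph 4).Adj k j → i ≠ k → f i < f j → f k < f j → False := by
    intro i j k h1 h2 hik hi hk
    have e1 := h _ _ hi (adj _ _ h1)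
    have e2 := h _ _ hk (adj _ _ h2)
    exact hik (hf (e1.trans e2.symm))
  have ne : ∀ i j : Fin 4, i ≠ j → f i ≠ f j := fun i j hij h => hij (hf h)
  have a01 : (SimpleGraph.cycleGraph 4).Adj 0 1 := by rw [SimpleGraph.cycleGraph_adj]; decide
  have a12 : (SimpleGraph.cycleGraph 4).Adj 1 2 := by rw [SimpleGraph.cycleGraph_adj]; decide
  have a23 : (SimpleGraph.cycleGraph 4).Adj 2 3 := by rw [SimpleGraph.cycleGraph_adj]; decide
  have a30 : (SimpleGraph.cycleGraph 4).Adj 3 0 := by rw [SimpleGraph.cycleGraph_adj]; decide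
  have k0 := key 3 0 1 a30 a01.symm (by decide)
  have k1 := key 0 1 2 a01 a12.symm (by decide)
  have k2 := key 1 2 3 a12 a23.symm (by decide)
  have k3 := key 2 3 0 a23 a30.symm (by decide)
  have n01 := ne 0 1 (by decide)
  have n12 := ne 1 2 (by decide)
  have n23 := ne 2 3 (by decide)
  have n30 := ne 3 0 (by decide)
  simp only [imp_false, not_lt] at k0 k1 k2 k3
  omega

/-- Builder can win within `k` more rounds from the position `(R, B)`. -/
inductive WK (n : ℕ) : ℕ → Set Edge → Set Edge → Prop
  | done {k : ℕ} {R B : Set Edge} (hc : B.ncard = n - 1)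
      (hp : HasCopy (SimpleGraph.pathGraph n) (SimpleGraph.fromEdgeSet B)) : WK n k R B
  | move {k : ℕ} {R B : Set Edge} (e : Edge) (hd : ¬ e.IsDiag) (he : e ∉ R ∪ B)
      (hb : WK n k R (insert e B)) (hr : C4Free (insert e R) → WK n k (insert e R) B) :
      WK n (k + 1) R B

lemma redSet_true (R₀ : Set Edge) (h : History) (e : Edge) :
    redSet R₀ (h ++ [(e, true)]) = insert e (redSet R₀ h) := by
  ext x; simp [redSet]; tauto

lemma redSet_false (R₀ : Set Edge) (h : History) (e : Edge) :
    redSet R₀ (h ++ [(e, false)]) = redSet R₀ h := by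
  ext x; simp [redSet]

lemma blueSet_true (R₀ : Set Edge) (h : History) (e : Edge) :
    blueSet R₀ (h ++ [(e, true)]) = blueSet R₀ h := by
  ext x; simp [blueSet]

lemma blueSet_false (R₀ : Set Edge) (h : History) (e : Edge) :
    blueSet R₀ (h ++ [(e, false)]) = insert e (blueSet R₀ h) := by
  ext x; simp [blueSet]; tauto

lemma gamePlay_length (B : BuilderStrat) (P : PainterStrat) (t : ℕ) :
    (gamePlay B P t).length = t := by
  induction t with
  | zero => rfl
  | succ t ih => simp [gamePlay, ih]

lemma finite_hist (R₀ : Set Edge) (hR : R₀.Finite) (h : History) (c : Bool) :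
    (R₀ ∪ {e | (e, c) ∈ h}).Finite := by
  refine hR.union ?_
  refine (List.finite_toSet (h.map Prod.fst)).subset ?_
  intro e he
  simp only [Set.mem_ofPred_eq, List.mem_map] at *
  exact ⟨_, he, rfl⟩

lemma exists_fresh (S : Set Edge) (hS : S.Finite) : ∃ e : Edge, ¬ e.IsDiag ∧ e ∉ S := by
  have hinj : Function.Injective (fun i : ℕ => s(0, i + 1)) := by
    intro i j hij
    simp at hij
    exact hij
  obtain ⟨e, he, hne⟩ := (Set.infinite_range_of_injective hinj).exists_notMem_finset hS.toFinset
  obtain ⟨i, rfl⟩ := he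
  exact ⟨s(0, i + 1), by simp [Sym2.mk_isDiag_iff], by simpa using hne⟩

lemma rrWin_of_WK {n : ℕ} {R₀ B₀ : Set Edge} (hR : R₀.Finite) (hB : B₀.Finite)
    (hle : (R₀ ∪ B₀).ncard ≤ 2 * n - 2)
    (hW : WK n (2 * n - 2 - (R₀ ∪ B₀).ncard) R₀ B₀) : RRWin n R₀ B₀ := by
  classical
  refine ⟨hle, ?_⟩
  generalize 2 * n - 2 - (R₀ ∪ B₀).ncard = m at hW ⊢
  let legal : History → Edge → Prop := fun h e =>
    ¬ e.IsDiag ∧ e ∉ redSet R₀ h ∪ blueSet B₀ h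
  let good : History → Edge → Prop := fun h e => legal h e ∧
    WK n (m - h.length - 1) (redSet R₀ h) (insert e (blueSet B₀ h)) ∧
    (C4Free (insert e (redSet R₀ h)) →
      WK n (m - h.length - 1) (insert e (redSet R₀ h)) (blueSet B₀ h))
  have hlegal : ∀ h, ∃ e, legal h e := fun h =>
    exists_fresh _ ((finite_hist R₀ hR h true).union (finite_hist B₀ hB h false))
  have hstrat : ∀ h, ∃ e, legal h e ∧ ((∃ e', good h e') → good h e) := by
    intro h
    by_cases hg : ∃ e', good h e'
    · obtain ⟨e, he⟩ := hg
      exact ⟨e, he.1, fun _ => he⟩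
    · obtain ⟨e, he⟩ := hlegal h
      exact ⟨e, he, fun h' => absurd h' hg⟩
  choose B hBl hBg using hstrat
  refine ⟨B, fun P t _ => hBl _, ?_⟩
  intro P hP
  by_contra hno
  push Not at hno
  have inv : ∀ t ≤ m, WK n (m - t) (redSet R₀ (gamePlay B P t))
      (blueSet B₀ (gamePlay B P t)) := by
    intro t
    induction t with
    | zero => intro _; simpa [gamePlay, redSet, blueSet] using hW
    | succ t ih =>
      intro ht
      have h1 := ih (by omega)
      have hn := hno t (by omega)
      have hgood : good (gamePlay B P t) (B (gamePlay B P t)) := by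
        apply hBg
        generalize hk : m - t = k at h1
        cases h1 with
        | done hc hp => exact absurd hp (hn hc)
        | @move k' _ _ e hd he hb hr =>
          refine ⟨e, ⟨hd, he⟩, ?_⟩
          rw [gamePlay_length]
          have : m - t - 1 = k' := by omega
          rw [this]
          exact ⟨hb, hr⟩
      obtain ⟨_, hb, hr⟩ := hgood
      rw [gamePlay_length] at hb hr
      have hm : m - (t + 1) = m - t - 1 := by omega
      rw [hm]
      simp only [gamePlay]
      cases hc : P (gamePlay B P t) (B (gamePlay B P t)) with
      | true =>
        rw [redSet_true, blueSet_true]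
        exact hr (hP _ _ hc)
      | false =>
        rw [redSet_false, blueSet_false]
        exact hb
  have hm := inv m le_rfl
  rw [Nat.sub_self] at hm
  cases hm with
  | done hc hp => exact hno m le_rfl hc hp

/-- Builder can win from the position `(R, B)` conceding at most `s` more red edges. -/
inductive W (n : ℕ) : ℕ → Set Edge → Set Edge → Prop
  | done {s : ℕ} {R B : Set Edge} (hc : B.ncard = n - 1)
      (hp : HasCopy (SimpleGraph.pathGraph n) (SimpleGraph.fromEdgeSet B)) : W n s R B
  | forced {s : ℕ} {R B : Set Edge} (e : Edge) (hd : ¬ e.IsDiag) (he : e ∉ R ∪ B)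
      (hb : W n s R (insert e B)) (hr : ¬ C4Free (insert e R)) : W n s R B
  | probe {s : ℕ} {R B : Set Edge} (e : Edge) (hd : ¬ e.IsDiag) (he : e ∉ R ∪ B)
      (hb : W n (s + 1) R (insert e B)) (hr : C4Free (insert e R) → W n s (insert e R) B) :
      W n (s + 1) R B

lemma W.succ {n s : ℕ} {R B : Set Edge} (h : W n s R B) : W n (s + 1) R B := by
  induction h with
  | done hc hp => exact .done hc hp
  | forced e hd he _ hr ih => exact .forced e hd he ih hr
  | probe e hd he _ _ ih1 ih2 => exact .probe e hd he ih1 ih2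

lemma W.add {n s : ℕ} {R B : Set Edge} (h : W n s R B) (t : ℕ) : W n (s + t) R B := by
  induction t with
  | zero => exact h
  | succ t ih => exact ih.succ

lemma W.toWK {n s : ℕ} {R B : Set Edge} (h : W n s R B) (hfin : B.Finite) :
    B.ncard ≤ n - 1 ∧ ∀ k, n - 1 + s ≤ k + B.ncard → WK n k R B := by
  induction h with
  | done hc hp => exact ⟨hc.le, fun k _ => .done hc hp⟩
  | @forced s R B e hd he _ hr ih =>
    obtain ⟨h1, h2⟩ := ih (hfin.insert e)
    have hcard : (insert e B).ncard = B.ncard + 1 :=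
      Set.ncard_insert_of_notMem (fun h => he (Or.inr h)) hfin
    rw [hcard] at h1 h2
    refine ⟨by omega, fun k hk => ?_⟩
    obtain ⟨k, rfl⟩ : ∃ k', k = k' + 1 := ⟨k - 1, by omega⟩
    exact .move e hd he (h2 k (by omega)) (fun h => absurd h hr)
  | @probe s R B e hd he _ _ ih1 ih2 =>
    obtain ⟨h1, h2⟩ := ih1 (hfin.insert e)
    have hcard : (insert e B).ncard = B.ncard + 1 :=
      Set.ncard_insert_of_notMem (fun h => he (Or.inr h)) hfin
    rw [hcard] at h1 h2
    refine ⟨by omega, fun k hk => ?_⟩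
    obtain ⟨k, rfl⟩ : ∃ k', k = k' + 1 := ⟨k - 1, by omega⟩
    exact .move e hd he (h2 k (by omega)) (fun h => (ih2 h hfin).2 k (by omega))

lemma W_of_forced_set {n s : ℕ} {R : Set Edge} (hR : C4Free R) (S : Finset Edge) :
    ∀ B : Set Edge, (∀ e ∈ S, ¬ e.IsDiag ∧ e ∉ B ∧ ¬ C4Free (insert e R)) →
      (B ∪ S).ncard = n - 1 →
      HasCopy (SimpleGraph.pathGraph n) (SimpleGraph.fromEdgeSet (B ∪ S)) → W n s R B := by
  induction S using Finset.induction_on with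
  | empty =>
    intro B _ hc hp
    simp only [Finset.coe_empty, Set.union_empty] at hc hp
    exact .done hc hp
  | insert e S heS ih =>
    intro B h hc hp
    have heq : B ∪ ((insert e S : Finset Edge) : Set Edge) = insert e B ∪ (S : Set Edge) := by
      ext x; simp; tauto
    rw [heq] at hc hp
    obtain ⟨hd, hB, hf⟩ := h e (Finset.mem_insert_self _ _)
    refine .forced e hd ?_ (ih _ ?_ hc hp) hf
    · rintro (h' | h')
      · rw [Set.insert_eq_of_mem h'] at hf
        exact hf hR
      · exact hB h'
    · intro e' he'
      obtain ⟨a, b, c⟩ := h e' (Finset.mem_insert_of_mem he')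
      refine ⟨a, ?_, c⟩
      rintro (rfl | h')
      · exact heS he'
      · exact b h'

/-- The edges of the path given by a list of vertices. -/
def pathE : List ℕ → Set Edge
  | [] => ∅
  | [_] => ∅
  | a :: b :: l => insert s(a, b) (pathE (b :: l))

lemma mem_pathE {e : Edge} : ∀ {L : List ℕ}, e ∈ pathE L ↔
    ∃ (i : ℕ) (h : i + 1 < L.length), e = s(L[i], L[i + 1])
  | [] => by simp [pathE]
  | [a] => by simp [pathE]
  | a :: b :: l => by
    simp only [pathE, Set.mem_insert_iff, mem_pathE (L := b :: l)]
    constructor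
    · rintro (rfl | ⟨i, h, rfl⟩)
      · exact ⟨0, by simp, rfl⟩
      · exact ⟨i + 1, by simpa using h, by simp⟩
    · rintro ⟨i, h, rfl⟩
      cases i with
      | zero => left; rfl
      | succ i => right; exact ⟨i, by simpa using h, by simp⟩

lemma pathE_append_right (l l' : List ℕ) : pathE l ⊆ pathE (l' ++ l) := by
  intro e he
  rw [mem_pathE] at *
  obtain ⟨i, h, rfl⟩ := he
  refine ⟨l'.length + i, by simp; omega, ?_⟩
  simp [List.getElem_append_right, Nat.add_assoc]

lemma pathE_append_left (l l' : List ℕ) : pathE l ⊆ pathE (l ++ l') := by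
  intro e he
  rw [mem_pathE] at *
  obtain ⟨i, h, rfl⟩ := he
  refine ⟨i, by simp; omega, ?_⟩
  rw [List.getElem_append_left (by omega), List.getElem_append_left (by omega)]

lemma pathE_reverse (l : List ℕ) : pathE l ⊆ pathE l.reverse := by
  intro e he
  rw [mem_pathE] at *
  obtain ⟨i, h, rfl⟩ := he
  refine ⟨l.length - 2 - i, by simp; omega, ?_⟩
  rw [Sym2.eq_swap]
  simp only [List.getElem_reverse]
  congr 2 <;> omega

lemma pathE_finite : ∀ l : List ℕ, (pathE l).Finite
  | [] => Set.finite_empty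
  | [_] => Set.finite_empty
  | _ :: b :: l => (pathE_finite (b :: l)).insert _

lemma mem_of_mem_pathE {e : Edge} {v : ℕ} : ∀ {l : List ℕ}, e ∈ pathE l → v ∈ e → v ∈ l
  | [], h, _ => absurd h (by simp [pathE])
  | [_], h, _ => absurd h (by simp [pathE])
  | a :: b :: l, h, hv => by
    rcases h with rfl | h
    · simp at hv; rcases hv with rfl | rfl <;> simp
    · exact List.mem_cons_of_mem _ (mem_of_mem_pathE h hv)

lemma pathE_ncard : ∀ {l : List ℕ}, l.Nodup → (pathE l).ncard = l.length - 1
  | [], _ => by simp [pathE]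
  | [_], _ => by simp [pathE]
  | a :: b :: l, h => by
    rw [pathE, Set.ncard_insert_of_notMem _ (pathE_finite _), pathE_ncard (l := b :: l)]
    · simp
    · exact h.of_cons
    · intro h'
      exact (List.nodup_cons.1 h).1 (mem_of_mem_pathE h' (by simp))

lemma hasCopy_path {L : List ℕ} (hL : L.Nodup) {n : ℕ} (hn : L.length = n) :
    HasCopy (SimpleGraph.pathGraph n) (SimpleGraph.fromEdgeSet (pathE L)) := by
  subst hn
  refine ⟨⟨fun i => L[i], ?_⟩, ?_⟩
  · intro i j hij
    rw [SimpleGraph.fromEdgeSet_adj]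
    refine ⟨?_, fun h => hij.ne (Fin.ext ((hL.getElem_inj_iff).1 h))⟩
    rw [SimpleGraph.pathGraph_adj] at hij
    rw [mem_pathE]
    rcases hij with hij | hij
    · refine ⟨i, by omega, ?_⟩
      simp [hij]
    · refine ⟨j, by omega, ?_⟩
      rw [Sym2.eq_swap]
      simp [hij]
  · intro i j h
    exact Fin.ext ((hL.getElem_inj_iff).1 h)

/-- The edge `ab` is blue or forced to be blue. -/
def OK (R B : Set Edge) (a b : ℕ) : Prop := s(a, b) ∈ B ∨ ¬ C4Free (insert s(a, b) R)

lemma OK.symm {R B : Set Edge} {a b : ℕ} (h : OK R B a b) : OK R B b a := by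
  unfold OK; rw [Sym2.eq_swap]; exact h

lemma C4Free.mono {R R' : Set Edge} (h : R ⊆ R') (hf : C4Free R') : C4Free R := by
  rintro ⟨f, hi⟩
  exact hf ⟨(SimpleGraph.Hom.ofLE (SimpleGraph.fromEdgeSet_mono h)).comp f, hi⟩

lemma OK.mono {R B R' B' : Set Edge} {a b : ℕ} (h : OK R B a b) (hR : R ⊆ R') (hB : B ⊆ B') :
    OK R' B' a b :=
  h.imp (fun h => hB h) (fun h h' => h (h'.mono (Set.insert_subset_insert hR)))

lemma W_of_path {n s : ℕ} {R B : Set Edge} (hR : C4Free R) {L : List ℕ} (hL : L.Nodup)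
    (hn : L.length = n) (hB : B ⊆ pathE L) (hch : L.IsChain (OK R B)) : W n s R B := by
  classical
  have hfin : (pathE L \ B).Finite := (pathE_finite L).sdiff
  have hu : B ∪ (hfin.toFinset : Set Edge) = pathE L := by
    rw [hfin.coe_toFinset]
    exact Set.union_sdiff_cancel hB
  refine W_of_forced_set hR hfin.toFinset B ?_ ?_ ?_
  · intro e he
    rw [Set.Finite.mem_toFinset] at he
    obtain ⟨h1, h2⟩ := he
    refine ⟨?_, h2, ?_⟩ <;> rw [mem_pathE] at h1 <;> obtain ⟨i, h, rfl⟩ := h1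
    · rw [Sym2.mk_isDiag_iff, hL.getElem_inj_iff]
      omega
    · exact (List.isChain_iff_getElem.1 hch i h).resolve_left h2
  · rw [hu, pathE_ncard hL, hn]
  · rw [hu]; exact hasCopy_path hL hn

lemma W_probe {n s : ℕ} {R B : Set Edge} (hR : C4Free R) {x z : ℕ} {ls : List ℕ}
    (hlen : 2 ≤ ls.length) (hls : ∀ y ∈ ls, s(y, z) ∈ R) (hnd : (x :: z :: ls).Nodup)
    (H : ∀ (R' B' : Set Edge) (w : ℕ) (ls' : List ℕ), ls.Perm (w :: ls') → OK R' B' x w →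
      R ⊆ R' → C4Free R' → B ⊆ B' → B' ⊆ insert s(x, w) B → W n s R' B') :
    W n (s + 1) R B := by
  match ls, hlen with
  | y :: y' :: l, _ =>
    have hy := hls y (by simp)
    have hy' := hls y' (by simp)
    simp only [List.nodup_cons, List.mem_cons, not_or] at hnd
    have hperm : (y :: y' :: l).Perm (y' :: y :: l) := List.Perm.swap _ _ _
    have hred : ∀ R' : Set Edge, R ⊆ R' → s(x, y) ∈ R' → C4Free R' → W n s R' B := by
      intro R' hRR h1 hf
      refine H R' B y' (y :: l) hperm (Or.inr ?_) hRR hf subset_rfl (Set.subset_insert _ _)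
      exact has_c4_of_path h1 (hRR hy) (by rw [Sym2.eq_swap]; exact hRR hy') (by tauto)
        (by tauto) (by tauto) (by grind) (by tauto) (by tauto)
    by_cases hxR : s(x, y) ∈ R
    · exact (hred R subset_rfl hxR hR).succ
    by_cases hxB : s(x, y) ∈ B
    · exact (H R B y (y' :: l) (List.Perm.refl _) (Or.inl hxB) subset_rfl hR subset_rfl
        (Set.subset_insert _ _)).succ
    refine .probe s(x, y) (by simp; tauto) (by simp; tauto) ?_ ?_
    · exact (H R _ y (y' :: l) (List.Perm.refl _) (Or.inl (Set.mem_insert _ _)) subset_rfl hR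
        (Set.subset_insert _ _) subset_rfl).succ
    · exact fun hf => hred _ (Set.subset_insert _ _) (Set.mem_insert _ _) hf

/-- The red edges of the initial position that matter. -/
structure Base (R : Set Edge) (xs ys : List ℕ) : Prop where
  r01 : s(0, 1) ∈ R
  r02 : s(0, 2) ∈ R
  r13 : s(1, 3) ∈ R
  r24 : s(2, 4) ∈ R
  r35 : s(3, 5) ∈ R
  rx : ∀ x ∈ xs, 6 ≤ x ∧ s(0, x) ∈ R
  ry : ∀ y ∈ ys, 6 ≤ y ∧ s(1, y) ∈ R
  disj : ∀ x ∈ xs, ∀ y ∈ ys, x ≠ y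

lemma Base.mono {R R' : Set Edge} {xs ys xs' ys' : List ℕ} (h : Base R xs ys) (hR : R ⊆ R')
    (hx : xs' ⊆ xs) (hy : ys' ⊆ ys) : Base R' xs' ys' :=
  ⟨hR h.r01, hR h.r02, hR h.r13, hR h.r24, hR h.r35,
    fun x hx' => ⟨(h.rx x (hx hx')).1, hR (h.rx x (hx hx')).2⟩,
    fun x hx' => ⟨(h.ry x (hy hx')).1, hR (h.ry x (hy hx')).2⟩,
    fun x hx' y hy' => h.disj x (hx hx') y (hy hy')⟩

lemma sw {R : Set Edge} {a b : ℕ} (h : s(a, b) ∈ R) : s(b, a) ∈ R := by rwa [Sym2.eq_swap]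

namespace Base
variable {R B : Set Edge} {xs ys : List ℕ}

lemma ok41 (h : Base R xs ys) : OK R B 4 1 :=
  Or.inr (has_c4_of_path (sw h.r24) (sw h.r02) h.r01 (by omega) (by omega) (by omega)
    (by omega) (by omega) (by omega))

lemma ok50 (h : Base R xs ys) : OK R B 5 0 :=
  Or.inr (has_c4_of_path (sw h.r35) (sw h.r13) (sw h.r01) (by omega) (by omega) (by omega)
    (by omega) (by omega) (by omega))

lemma ok4x (h : Base R xs ys) {x : ℕ} (hx : x ∈ xs) : OK R B 4 x := by
  have := h.rx x hx
  exact Or.inr (has_c4_of_path (sw h.r24) (sw h.r02) this.2 (by omega) (by omega) (by omega)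
    (by omega) (by omega) (by omega))

lemma ok5y (h : Base R xs ys) {y : ℕ} (hy : y ∈ ys) : OK R B 5 y := by
  have := h.ry y hy
  exact Or.inr (has_c4_of_path (sw h.r35) (sw h.r13) this.2 (by omega) (by omega) (by omega)
    (by omega) (by omega) (by omega))

lemma okxy (h : Base R xs ys) {x y : ℕ} (hx : x ∈ xs ++ [2]) (hy : y ∈ 3 :: ys) :
    OK R B x y := by
  have h1 : s(0, x) ∈ R ∧ (6 ≤ x ∨ x = 2) := by
    rcases List.mem_append.1 hx with hx | hx
    · exact ⟨(h.rx x hx).2, Or.inl (h.rx x hx).1⟩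
    · simp at hx; subst hx; exact ⟨h.r02, Or.inr rfl⟩
  have h2 : s(1, y) ∈ R ∧ (6 ≤ y ∨ y = 3) := by
    rcases List.mem_cons.1 hy with rfl | hy
    · exact ⟨h.r13, Or.inr rfl⟩
    · exact ⟨(h.ry y hy).2, Or.inl (h.ry y hy).1⟩
  have h3 : x ≠ y := by
    rcases List.mem_append.1 hx with hx | hx <;> rcases List.mem_cons.1 hy with hy | hy
    · have := h.rx x hx; omega
    · exact h.disj x hx y hy
    · simp at hx; omega
    · have := h.ry y hy; simp at hx; omega
  exact Or.inr (has_c4_of_path (sw h1.1) h.r01 h2.1 (by omega) (by omega) h3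
    (by omega) (by omega) (by omega))

end Base

/-- Interleaving of two lists. -/
def zz : List ℕ → List ℕ → List ℕ
  | a :: as, b :: bs => a :: b :: zz as bs
  | _, _ => []

lemma zz_perm : ∀ (as bs : List ℕ), as.length = bs.length → (zz as bs).Perm (as ++ bs)
  | [], [], _ => by simp [zz]
  | a :: as, b :: bs, h => by
    have ih := zz_perm as bs (by simpa using h)
    rw [List.perm_iff_count] at *
    intro c
    have := ih c
    simp only [zz, List.count_cons, List.count_append] at *
    omega

lemma zz_chain {Q : ℕ → ℕ → Prop} {t : ℕ} {ts : List ℕ} (ht : (t :: ts).IsChain Q) :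
    ∀ (as bs : List ℕ) (v : ℕ), as.length = bs.length → as ≠ [] →
      (∀ a, as.head? = some a → Q v a) → (∀ a ∈ as, ∀ b ∈ bs, Q a b ∧ Q b a) →
      (∀ b, bs.getLast? = some b → Q b t) → (v :: (zz as bs ++ t :: ts)).IsChain Q
  | [], _, _, _, h, _, _, _ => absurd rfl h
  | [a], [b], v, _, _, h1, h2, h3 => by
    simp only [zz, List.cons_append, List.nil_append, List.isChain_cons_cons]
    exact ⟨h1 a rfl, (h2 a (by simp) b (by simp)).1, h3 b rfl, ht⟩
  | a :: a' :: as, b :: b' :: bs, v, h, _, h1, h2, h3 => by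
    have ih := zz_chain ht (a' :: as) (b' :: bs) b (by simpa using h) (by simp)
      (by
        intro c hc
        simp at hc
        subst hc
        exact (h2 a' (by simp) b (by simp)).2)
      (fun c hc d hd => h2 c (List.mem_cons_of_mem _ hc) d (List.mem_cons_of_mem _ hd))
      (fun c hc => h3 c (by simpa using hc))
    rw [zz, List.cons_append, List.cons_append, List.isChain_cons_cons, List.isChain_cons_cons]
    exact ⟨h1 a rfl, (h2 a (by simp) b (by simp)).1, ih⟩

lemma assemble {n s : ℕ} {R B : Set Edge} (hR : C4Free R) {xs ys xb yb : List ℕ}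
    (base : Base R xs ys) (nd : (0 :: 1 :: 2 :: 3 :: 4 :: 5 :: (xs ++ ys ++ xb ++ yb)).Nodup)
    (hn : 6 + xs.length + ys.length + xb.length + yb.length = n)
    (Lb Rb ux uy xs' ys' : List ℕ) (hxs : xs.Perm (ux ++ xs')) (hys : ys.Perm (uy ++ ys'))
    (hp : (Lb ++ Rb).Perm (0 :: 1 :: (ux ++ uy ++ xb ++ yb)))
    (hlen : xs'.length = ys'.length) (hpos : 0 < xs'.length)
    (hL : (4 :: Lb).IsChain (OK R B)) (hRt : (5 :: Rb).IsChain (OK R B))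
    (hB : B ⊆ pathE (4 :: Lb) ∪ pathE (5 :: Rb)) : W n s R B := by
  have base' : Base R xs' ys' := base.mono subset_rfl
    (fun x hx => hxs.mem_iff.2 (List.mem_append_right _ hx))
    (fun x hx => hys.mem_iff.2 (List.mem_append_right _ hx))
  have hzz := zz_perm (xs' ++ [2]) (3 :: ys') (by simp [hlen])
  have hperm : (Lb.reverse ++ 4 :: (zz (xs' ++ [2]) (3 :: ys') ++ 5 :: Rb)).Perm
      (0 :: 1 :: 2 :: 3 :: 4 :: 5 :: (xs ++ ys ++ xb ++ yb)) := by
    rw [List.perm_iff_count] at *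
    intro c
    have e1 := hxs c
    have e2 := hys c
    have e3 := hp c
    have e4 := hzz c
    simp only [List.count_cons, List.count_append, List.count_reverse, List.count_nil] at *
    omega
  refine W_of_path hR (hperm.nodup_iff.2 nd) ?_ ?_ ?_
  · rw [hperm.length_eq, ← hn]
    simp; omega
  · refine hB.trans (Set.union_subset ?_ ?_)
    · refine (pathE_reverse _).trans ?_
      have : Lb.reverse ++ 4 :: (zz (xs' ++ [2]) (3 :: ys') ++ 5 :: Rb) =
        (4 :: Lb).reverse ++ (zz (xs' ++ [2]) (3 :: ys') ++ 5 :: Rb) := by simp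
      rw [this]
      exact pathE_append_left _ _
    · have : Lb.reverse ++ 4 :: (zz (xs' ++ [2]) (3 :: ys') ++ 5 :: Rb) =
        (Lb.reverse ++ 4 :: zz (xs' ++ [2]) (3 :: ys')) ++ (5 :: Rb) := by simp
      rw [this]
      exact pathE_append_right _ _
  · rw [List.isChain_split]
    constructor
    · rw [← List.reverse_cons, List.isChain_reverse]
      exact hL.imp (fun a b h => h.symm)
    · refine zz_chain hRt _ _ _ (by simp [hlen]) (by simp) ?_ ?_ ?_
      · intro a ha
        cases xs' with
        | nil => simp at hpos
        | cons x l =>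
          simp at ha; subst ha
          exact base'.ok4x (by simp)
      · intro a ha b hb
        exact ⟨base'.okxy ha hb, (base'.okxy ha hb).symm⟩
      · intro b hb
        have hne : ys' ≠ [] := by rintro rfl; simp at hlen; simp [hlen] at hpos
        rw [List.getLast?_cons, Option.some_inj] at hb
        rw [List.getLast?_eq_some_getLast hne, Option.getD_some] at hb
        subst hb
        exact (base'.ok5y (List.getLast_mem hne)).symm

/-- The blue edges of the initial position. -/
def blueE (xb yb : List ℕ) : Set Edge :=
  {e | (∃ x ∈ xb, e = s(0, x)) ∨ ∃ y ∈ yb, e = s(1, y)}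

set_option linter.unusedSimpArgs false in
set_option maxHeartbeats 4000000 in
lemma abstract_win {xs ys xb yb : List ℕ} {R : Set Edge} (hR : C4Free R) (base : Base R xs ys)
    (nd : (0 :: 1 :: 2 :: 3 :: 4 :: 5 :: (xs ++ ys ++ xb ++ yb)).Nodup)
    (hx2 : 2 ≤ xs.length) (hy2 : 2 ≤ ys.length) (hxb1 : 1 ≤ xb.length) (hxb2 : xb.length ≤ 2)
    (hyb : yb.length ≤ xb.length)
    (hpq : xs.length + xb.length = ys.length + yb.length ∨
      xs.length + xb.length = ys.length + yb.length + 1)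
    (hboth : xb.length = 2 → yb.length = 2 → xs.length + xb.length = ys.length + yb.length) :
    W (6 + xs.length + ys.length + xb.length + yb.length) (xb.length + yb.length) R
      (blueE xb yb) := by
  have ndx : ∀ x ∈ xb, (x :: 1 :: ys).Nodup := by
    intro x hx
    rw [List.nodup_iff_count_le_one] at *
    intro c
    have h1 := nd c
    have h2 := List.count_pos_iff.2 hx
    simp only [List.count_cons, List.count_append, beq_iff_eq] at *
    by_cases hc : x = c
    · subst hc; simp only [if_true]; omega
    · simp only [hc, if_false]; omega
  have ndy : ∀ y ∈ yb, (y :: 0 :: xs).Nodup := by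
    intro x hx
    rw [List.nodup_iff_count_le_one] at *
    intro c
    have h1 := nd c
    have h2 := List.count_pos_iff.2 hx
    simp only [List.count_cons, List.count_append, beq_iff_eq] at *
    by_cases hc : x = c
    · subst hc; simp only [if_true]; omega
    · simp only [hc, if_false]; omega
  have ry : ∀ y ∈ ys, s(y, 1) ∈ R := fun y hy => sw (base.ry y hy).2
  have rx : ∀ x ∈ xs, s(x, 0) ∈ R := fun x hx => sw (base.rx x hx).2
  have p0 : ∀ l : List ℕ, l.Perm ([] ++ l) := fun l => List.Perm.refl _
  have bx : ∀ (R' B' : Set Edge), blueE xb yb ⊆ B' → ∀ x ∈ xb, OK R' B' 0 x :=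
    fun R' B' h x hx => Or.inl (h (Or.inl ⟨x, hx, rfl⟩))
  have bY : ∀ (R' B' : Set Edge), blueE xb yb ⊆ B' → ∀ y ∈ yb, OK R' B' 1 y :=
    fun R' B' h y hy => Or.inl (h (Or.inr ⟨y, hy, rfl⟩))
  have sub : ∀ {l l' : List ℕ} {w : ℕ}, l.Perm (w :: l') → w ∈ l ∧ ∀ y ∈ l', y ∈ l := fun h =>
    ⟨h.mem_iff.2 (by simp), fun y hy => h.mem_iff.2 (by simp [hy])⟩
  have ndsub : ∀ {l l' : List ℕ} {w a b : ℕ}, l.Perm (w :: l') → (a :: b :: l).Nodup →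
      (a :: b :: l').Nodup := by
    intro l l' w a b h hn
    have h2 : (a :: b :: l).Perm (a :: b :: w :: l') := (h.cons b).cons a
    refine (h2.nodup_iff.1 hn).sublist ?_
    exact ((List.sublist_cons_self w l').cons_cons b).cons_cons a
  match xb, yb, hxb1, hxb2, hyb with
  | [x1], [], _, _, _ =>
    rcases hpq with hpq | hpq
    · refine W_probe (s := 0) hR hy2 ry (ndx x1 (by simp)) ?_
      intro R1 B1 w1 l1 hl1 ok1 hRR1 hf1 hBB1 hB1
      have hle1 := hl1.length_eq
      have base1 := base.mono hRR1 (List.Subset.refl _) (List.Subset.refl _)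
      refine assemble hf1 base1 nd rfl [1] [0, x1, w1] [] [w1] xs l1 (p0 _) hl1 ?_ ?_ ?_ ?_ ?_ ?_
      · rw [List.perm_iff_count]; intro c
        simp only [List.count_cons, List.count_append, List.count_nil, List.append_nil,
          List.nil_append, List.cons_append]
        omega
      · simp only [List.length_cons, List.length_nil] at *; omega
      · simp only [List.length_cons, List.length_nil] at *; omega
      · simp only [List.isChain_cons_cons, List.isChain_singleton, and_true]
        exact base1.ok41
      · simp only [List.isChain_cons_cons, List.isChain_singleton, and_true]
        exact ⟨base1.ok50, bx _ _ hBB1 x1 (by simp), ok1⟩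
      · intro e he
        replace he := hB1 he
        rw [Set.mem_insert_iff] at he
        simp [blueE, or_assoc] at he
        rcases he with rfl | rfl <;> simp [pathE]
    · refine assemble hR base nd rfl [1] [0, x1] [] [] xs ys (p0 _) (p0 _) ?_ ?_ ?_ ?_ ?_ ?_
      · rw [List.perm_iff_count]; intro c
        simp only [List.count_cons, List.count_append, List.count_nil, List.append_nil,
          List.nil_append, List.cons_append]
        omega
      · simp only [List.length_cons, List.length_nil] at *; omega
      · simp only [List.length_cons, List.length_nil] at *; omega
      · simp only [List.isChain_cons_cons, List.isChain_singleton, and_true]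
        exact base.ok41
      · simp only [List.isChain_cons_cons, List.isChain_singleton, and_true]
        exact ⟨base.ok50, bx _ _ subset_rfl x1 (by simp)⟩
      · intro e he
        simp [blueE, or_assoc] at he
        rcases he with rfl <;> simp [pathE]
  | [x1], [y1], _, _, _ =>
    rcases hpq with hpq | hpq
    · refine assemble hR base nd rfl [1, y1] [0, x1] [] [] xs ys (p0 _) (p0 _) ?_ ?_ ?_ ?_ ?_ ?_
      · rw [List.perm_iff_count]; intro c
        simp only [List.count_cons, List.count_append, List.count_nil, List.append_nil,
          List.nil_append, List.cons_append]
        omega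
      · simp only [List.length_cons, List.length_nil] at *; omega
      · simp only [List.length_cons, List.length_nil] at *; omega
      · simp only [List.isChain_cons_cons, List.isChain_singleton, and_true]
        exact ⟨base.ok41, bY _ _ subset_rfl y1 (by simp)⟩
      · simp only [List.isChain_cons_cons, List.isChain_singleton, and_true]
        exact ⟨base.ok50, bx _ _ subset_rfl x1 (by simp)⟩
      · intro e he
        simp [blueE, or_assoc] at he
        rcases he with rfl | rfl <;> simp [pathE]
    · refine W_probe (s := 1) hR hx2 rx (ndy y1 (by simp)) ?_
      intro R1 B1 w1 l1 hl1 ok1 hRR1 hf1 hBB1 hB1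
      have hle1 := hl1.length_eq
      have base1 := base.mono hRR1 (List.Subset.refl _) (List.Subset.refl _)
      refine assemble hf1 base1 nd rfl [1, y1, w1] [0, x1] [w1] [] l1 ys hl1 (p0 _) ?_ ?_ ?_ ?_ ?_ ?_
      · rw [List.perm_iff_count]; intro c
        simp only [List.count_cons, List.count_append, List.count_nil, List.append_nil,
          List.nil_append, List.cons_append]
        omega
      · simp only [List.length_cons, List.length_nil] at *; omega
      · simp only [List.length_cons, List.length_nil] at *; omega
      · simp only [List.isChain_cons_cons, List.isChain_singleton, and_true]
        exact ⟨base1.ok41, bY _ _ hBB1 y1 (by simp), ok1⟩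
      · simp only [List.isChain_cons_cons, List.isChain_singleton, and_true]
        exact ⟨base1.ok50, bx _ _ hBB1 x1 (by simp)⟩
      · intro e he
        replace he := hB1 he
        rw [Set.mem_insert_iff] at he
        simp [blueE, or_assoc] at he
        rcases he with rfl | rfl | rfl <;> simp [pathE]
  | [x1, x2], [], _, _, _ =>
    rcases hpq with hpq | hpq
    · refine W_probe (s := 1) hR hy2 ry (ndx x1 (by simp)) ?_
      intro R1 B1 w1 l1 hl1 ok1 hRR1 hf1 hBB1 hB1
      have hle1 := hl1.length_eq
      have base1 := base.mono hRR1 (List.Subset.refl _) (List.Subset.refl _)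
      refine W_probe (s := 0) hf1 (by simp only [List.length_cons, List.length_nil] at *; omega) (fun y hy => hRR1 (ry y ((sub hl1).2 y hy))) (ndsub hl1 (ndx x2 (by simp))) ?_
      intro R2 B2 w2 l2 hl2 ok2 hRR2 hf2 hBB2 hB2
      have hle2 := hl2.length_eq
      have base2 := base1.mono hRR2 (List.Subset.refl _) (List.Subset.refl _)
      have hl3 : ys.Perm ([w1, w2] ++ l2) := hl1.trans (hl2.cons w1)
      refine assemble hf2 base2 nd rfl [1] [w1, x1, 0, x2, w2] [] [w1, w2] xs l2 (p0 _) hl3 ?_ ?_ ?_ ?_ ?_ ?_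
      · rw [List.perm_iff_count]; intro c
        simp only [List.count_cons, List.count_append, List.count_nil, List.append_nil,
          List.nil_append, List.cons_append]
        omega
      · simp only [List.length_cons, List.length_nil] at *; omega
      · simp only [List.length_cons, List.length_nil] at *; omega
      · simp only [List.isChain_cons_cons, List.isChain_singleton, and_true]
        exact base2.ok41
      · simp only [List.isChain_cons_cons, List.isChain_singleton, and_true]
        exact ⟨base2.ok5y (sub hl1).1, (ok1.mono hRR2 hBB2).symm, (bx _ _ (hBB1.trans hBB2) x1 (by simp)).symm, bx _ _ (hBB1.trans hBB2) x2 (by simp), ok2⟩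
      · intro e he
        replace he := hB2 he
        rw [Set.mem_insert_iff] at he
        replace he := he.imp_right (fun h => hB1 h)
        rw [Set.mem_insert_iff] at he
        simp [blueE, or_assoc] at he
        rcases he with rfl | rfl | rfl | rfl <;> simp [pathE]
    · refine W_probe (s := 1) hR hy2 ry (ndx x1 (by simp)) ?_
      intro R1 B1 w1 l1 hl1 ok1 hRR1 hf1 hBB1 hB1
      have hle1 := hl1.length_eq
      have base1 := base.mono hRR1 (List.Subset.refl _) (List.Subset.refl _)
      refine assemble hf1 base1 nd rfl [1] [w1, x1, 0, x2] [] [w1] xs l1 (p0 _) hl1 ?_ ?_ ?_ ?_ ?_ ?_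
      · rw [List.perm_iff_count]; intro c
        simp only [List.count_cons, List.count_append, List.count_nil, List.append_nil,
          List.nil_append, List.cons_append]
        omega
      · simp only [List.length_cons, List.length_nil] at *; omega
      · simp only [List.length_cons, List.length_nil] at *; omega
      · simp only [List.isChain_cons_cons, List.isChain_singleton, and_true]
        exact base1.ok41
      · simp only [List.isChain_cons_cons, List.isChain_singleton, and_true]
        exact ⟨base1.ok5y (sub hl1).1, ok1.symm, (bx _ _ hBB1 x1 (by simp)).symm, bx _ _ hBB1 x2 (by simp)⟩
      · intro e he
        replace he := hB1 he
        rw [Set.mem_insert_iff] at he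
        simp [blueE, or_assoc] at he
        rcases he with rfl | rfl | rfl <;> simp [pathE]
  | [x1, x2], [y1], _, _, _ =>
    rcases hpq with hpq | hpq
    · refine W_probe (s := 2) hR hy2 ry (ndx x1 (by simp)) ?_
      intro R1 B1 w1 l1 hl1 ok1 hRR1 hf1 hBB1 hB1
      have hle1 := hl1.length_eq
      have base1 := base.mono hRR1 (List.Subset.refl _) (List.Subset.refl _)
      refine assemble hf1 base1 nd rfl [1, y1] [w1, x1, 0, x2] [] [w1] xs l1 (p0 _) hl1 ?_ ?_ ?_ ?_ ?_ ?_
      · rw [List.perm_iff_count]; intro c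
        simp only [List.count_cons, List.count_append, List.count_nil, List.append_nil,
          List.nil_append, List.cons_append]
        omega
      · simp only [List.length_cons, List.length_nil] at *; omega
      · simp only [List.length_cons, List.length_nil] at *; omega
      · simp only [List.isChain_cons_cons, List.isChain_singleton, and_true]
        exact ⟨base1.ok41, bY _ _ hBB1 y1 (by simp)⟩
      · simp only [List.isChain_cons_cons, List.isChain_singleton, and_true]
        exact ⟨base1.ok5y (sub hl1).1, ok1.symm, (bx _ _ hBB1 x1 (by simp)).symm, bx _ _ hBB1 x2 (by simp)⟩
      · intro e he
        replace he := hB1 he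
        rw [Set.mem_insert_iff] at he
        simp [blueE, or_assoc] at he
        rcases he with rfl | rfl | rfl | rfl <;> simp [pathE]
    · refine W_probe (s := 2) hR hy2 ry (ndx x1 (by simp)) ?_
      intro R1 B1 w1 l1 hl1 ok1 hRR1 hf1 hBB1 hB1
      have hle1 := hl1.length_eq
      have base1 := base.mono hRR1 (List.Subset.refl _) (List.Subset.refl _)
      refine W_probe (s := 1) hf1 hx2 (fun x hx => hRR1 (rx x hx)) (ndy y1 (by simp)) ?_
      intro R2 B2 w2 l2 hl2 ok2 hRR2 hf2 hBB2 hB2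
      have hle2 := hl2.length_eq
      have base2 := base1.mono hRR2 (List.Subset.refl _) (List.Subset.refl _)
      refine assemble hf2 base2 nd rfl [1, y1, w2] [w1, x1, 0, x2] [w2] [w1] l2 l1 hl2 hl1 ?_ ?_ ?_ ?_ ?_ ?_
      · rw [List.perm_iff_count]; intro c
        simp only [List.count_cons, List.count_append, List.count_nil, List.append_nil,
          List.nil_append, List.cons_append]
        omega
      · simp only [List.length_cons, List.length_nil] at *; omega
      · simp only [List.length_cons, List.length_nil] at *; omega
      · simp only [List.isChain_cons_cons, List.isChain_singleton, and_true]
        exact ⟨base2.ok41, bY _ _ (hBB1.trans hBB2) y1 (by simp), ok2⟩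
      · simp only [List.isChain_cons_cons, List.isChain_singleton, and_true]
        exact ⟨base2.ok5y (sub hl1).1, (ok1.mono hRR2 hBB2).symm, (bx _ _ (hBB1.trans hBB2) x1 (by simp)).symm, bx _ _ (hBB1.trans hBB2) x2 (by simp)⟩
      · intro e he
        replace he := hB2 he
        rw [Set.mem_insert_iff] at he
        replace he := he.imp_right (fun h => hB1 h)
        rw [Set.mem_insert_iff] at he
        simp [blueE, or_assoc] at he
        rcases he with rfl | rfl | rfl | rfl | rfl <;> simp [pathE]
  | [x1, x2], [y1, y2], _, _, _ =>
    have hpq := hboth rfl rfl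
    · refine W_probe (s := 3) hR hy2 ry (ndx x1 (by simp)) ?_
      intro R1 B1 w1 l1 hl1 ok1 hRR1 hf1 hBB1 hB1
      have hle1 := hl1.length_eq
      have base1 := base.mono hRR1 (List.Subset.refl _) (List.Subset.refl _)
      refine W_probe (s := 2) hf1 hx2 (fun x hx => hRR1 (rx x hx)) (ndy y1 (by simp)) ?_
      intro R2 B2 w2 l2 hl2 ok2 hRR2 hf2 hBB2 hB2
      have hle2 := hl2.length_eq
      have base2 := base1.mono hRR2 (List.Subset.refl _) (List.Subset.refl _)
      refine assemble hf2 base2 nd rfl [w2, y1, 1, y2] [w1, x1, 0, x2] [w2] [w1] l2 l1 hl2 hl1 ?_ ?_ ?_ ?_ ?_ ?_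
      · rw [List.perm_iff_count]; intro c
        simp only [List.count_cons, List.count_append, List.count_nil, List.append_nil,
          List.nil_append, List.cons_append]
        omega
      · simp only [List.length_cons, List.length_nil] at *; omega
      · simp only [List.length_cons, List.length_nil] at *; omega
      · simp only [List.isChain_cons_cons, List.isChain_singleton, and_true]
        exact ⟨base2.ok4x (sub hl2).1, ok2.symm, (bY _ _ (hBB1.trans hBB2) y1 (by simp)).symm, bY _ _ (hBB1.trans hBB2) y2 (by simp)⟩
      · simp only [List.isChain_cons_cons, List.isChain_singleton, and_true]
        exact ⟨base2.ok5y (sub hl1).1, (ok1.mono hRR2 hBB2).symm, (bx _ _ (hBB1.trans hBB2) x1 (by simp)).symm, bx _ _ (hBB1.trans hBB2) x2 (by simp)⟩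
      · intro e he
        replace he := hB2 he
        rw [Set.mem_insert_iff] at he
        replace he := he.imp_right (fun h => hB1 h)
        rw [Set.mem_insert_iff] at he
        simp [blueE, or_assoc] at he
        rcases he with rfl | rfl | rfl | rfl | rfl | rfl <;> simp [pathE]

/-- The star with centre `c` and leaves the members of `l`. -/
def star (c : ℕ) (l : List ℕ) : Set Edge := {e | ∃ v ∈ l, e = s(c, v)}

lemma star_ncard (c : ℕ) {l : List ℕ} (h : l.Nodup) : (star c l).ncard = l.length := by
  have h1 : star c l = (fun v => s(c, v)) '' (l.toFinset : Set ℕ) := by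
    ext e; simp [star, eq_comm]
  rw [h1, Set.ncard_image_of_injective, Set.ncard_coe_finset, List.toFinset_card_of_nodup h]
  intro v w hvw
  have h2 : s(c, v) = s(c, w) := hvw
  rw [Sym2.eq_iff] at h2
  omega

lemma star_finite (c : ℕ) (l : List ℕ) : (star c l).Finite := by
  have h1 : star c l = (fun v => s(c, v)) '' (l.toFinset : Set ℕ) := by
    ext e; simp [star, eq_comm]
  rw [h1]
  exact (Finset.finite_toSet _).image _

lemma wing1_eq (p : ℕ) : wing1 p = star 0 (List.range' 6 p) := by
  ext e
  simp only [wing1, star, Set.mem_ofPred_eq, List.mem_range'_1]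
  constructor
  · rintro ⟨i, h1, h2, rfl⟩; exact ⟨5 + i, by omega, rfl⟩
  · rintro ⟨v, h1, rfl⟩; exact ⟨v - 5, by omega, by omega, by congr 2; omega⟩

lemma wing2_eq (p q : ℕ) : wing2 p q = star 1 (List.range' (6 + p) q) := by
  ext e
  simp only [wing2, star, Set.mem_ofPred_eq, List.mem_range'_1]
  constructor
  · rintro ⟨i, h1, h2, rfl⟩; exact ⟨5 + p + i, by omega, rfl⟩
  · rintro ⟨v, h1, rfl⟩; exact ⟨v - 5 - p, by omega, by omega, by congr 2; omega⟩

open Classical in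
lemma star_inter (c : ℕ) (l : List ℕ) (Bl : Set Edge) :
    star c l ∩ Bl = star c (l.filter (fun v => s(c, v) ∈ Bl)) := by
  ext e
  simp only [star, Set.mem_inter_iff, Set.mem_ofPred_eq, List.mem_filter, decide_eq_true_eq]
  constructor
  · rintro ⟨⟨v, h, rfl⟩, h2⟩; exact ⟨v, ⟨h, h2⟩, rfl⟩
  · rintro ⟨v, ⟨h, h2⟩, rfl⟩; exact ⟨⟨v, h, rfl⟩, h2⟩

open Classical in
lemma star_diff (c : ℕ) (l : List ℕ) (Bl : Set Edge) :
    star c l \ Bl = star c (l.filter (fun v => ¬ s(c, v) ∈ Bl)) := by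
  ext e
  simp only [star, Set.mem_sdiff, Set.mem_ofPred_eq, List.mem_filter, decide_eq_true_eq]
  constructor
  · rintro ⟨⟨v, h, rfl⟩, h2⟩; exact ⟨v, ⟨h, h2⟩, rfl⟩
  · rintro ⟨v, ⟨h, h2⟩, rfl⟩; exact ⟨⟨v, h, rfl⟩, h2⟩

lemma butterfly_c4Free (p q : ℕ) : C4Free (centralPathEdges ∪ wing1 p ∪ wing2 p q) := by
  refine c4Free_of_parent
    (fun b => if b ≤ 2 then 0 else if b = 3 then 1 else if b = 4 then 2 else if b = 5 then 3 else
      if b < 6 + p then 0 else 1) ?_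
  intro a b hab h
  simp only [centralPathEdges, wing1, wing2, Set.mem_union, Set.mem_insert_iff,
    Set.mem_singleton_iff, Set.mem_ofPred_eq, Sym2.eq_iff] at h
  rcases h with (h | ⟨i, h1, h2, h⟩) | ⟨i, h1, h2, h⟩ <;> split_ifs <;> omega

/-- Let `q ≥ 2`, `p ∈ {q, q + 1}` and let `H` be a coloured `(p, q)`-butterfly with
centres `(c₁, c₂)` whose blue edges form the set `Bl`, such that: the central path
is red, each wing contains at least two red edges, the `c₁`-wing contains exactly
one or two blue edges, the `c₂`-wing contains at most as many blue edges as the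
`c₁`-wing, and if each wing contains two blue edges then `p = q`.  Then Builder has
a winning strategy in `RR(C₄, P_{v(H)}, H)`. -/
theorem RR_win_coloured_butterfly (p q : ℕ) (hq : 2 ≤ q) (hpq : p = q ∨ p = q + 1)
    (Bl : Set Edge) (hBl : Bl ⊆ wing1 p ∪ wing2 p q)
    (hred1 : 2 ≤ (wing1 p \ Bl).ncard)
    (hred2 : 2 ≤ (wing2 p q \ Bl).ncard)
    (hblue1 : 1 ≤ (wing1 p ∩ Bl).ncard)
    (hblue1' : (wing1 p ∩ Bl).ncard ≤ 2)
    (hblue2 : (wing2 p q ∩ Bl).ncard ≤ (wing1 p ∩ Bl).ncard)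
    (hboth : (wing1 p ∩ Bl).ncard = 2 → (wing2 p q ∩ Bl).ncard = 2 → p = q) :
    RRWin (6 + p + q) ((centralPathEdges ∪ wing1 p ∪ wing2 p q) \ Bl) Bl := by
  classical
  rw [wing1_eq, wing2_eq] at *
  have hc4 := butterfly_c4Free p q
  rw [wing1_eq, wing2_eq] at hc4
  set l1 := List.range' 6 p with hl1
  set l2 := List.range' (6 + p) q with hl2
  have n1 : l1.Nodup := List.nodup_range'
  have n2 : l2.Nodup := List.nodup_range'
  have m1 : ∀ v ∈ l1, 6 ≤ v ∧ v < 6 + p := fun v hv => by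
    rw [hl1, List.mem_range'_1] at hv; exact hv
  have m2 : ∀ v ∈ l2, 6 + p ≤ v := fun v hv => by
    rw [hl2, List.mem_range'_1] at hv; exact hv.1
  have len1 : l1.length = p := List.length_range'
  have len2 : l2.length = q := List.length_range'
  set xb := l1.filter (fun v => s(0, v) ∈ Bl) with hxb
  set xs := l1.filter (fun v => ¬ s(0, v) ∈ Bl) with hxs
  set yb := l2.filter (fun v => s(1, v) ∈ Bl) with hyb
  set ys := l2.filter (fun v => ¬ s(1, v) ∈ Bl) with hys
  have px : (xb ++ xs).Perm l1 := by
    rw [hxb, hxs]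
    simpa using List.filter_append_perm (fun v => decide (s(0, v) ∈ Bl)) l1
  have py : (yb ++ ys).Perm l2 := by
    rw [hyb, hys]
    simpa using List.filter_append_perm (fun v => decide (s(1, v) ∈ Bl)) l2
  have lx : xb.length + xs.length = p := by rw [← len1, ← px.length_eq, List.length_append]
  have ly : yb.length + ys.length = q := by rw [← len2, ← py.length_eq, List.length_append]
  have c1 : (star 0 l1 ∩ Bl).ncard = xb.length := by
    rw [star_inter, star_ncard _ (n1.filter _)]
  have c2 : (star 1 l2 ∩ Bl).ncard = yb.length := by
    rw [star_inter, star_ncard _ (n2.filter _)]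
  have c3 : (star 0 l1 \ Bl).ncard = xs.length := by
    rw [star_diff, star_ncard _ (n1.filter _)]
  have c4 : (star 1 l2 \ Bl).ncard = ys.length := by
    rw [star_diff, star_ncard _ (n2.filter _)]
  rw [c1] at hblue1 hblue1' hblue2 hboth
  rw [c2] at hblue2 hboth
  rw [c3] at hred1
  rw [c4] at hred2
  have hBl2 : Bl = star 0 l1 ∩ Bl ∪ star 1 l2 ∩ Bl := by
    rw [← Set.union_inter_distrib_right]
    exact (Set.inter_eq_right.2 hBl).symm
  have hBE : blueE xb yb = Bl := by
    conv_rhs => rw [hBl2, star_inter, star_inter]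
    rfl
  have hBfin : Bl.Finite := ((star_finite 0 l1).union (star_finite 1 l2)).subset hBl
  have hdisj : Disjoint (star 0 l1 ∩ Bl) (star 1 l2 ∩ Bl) := by
    rw [Set.disjoint_left]
    rintro e ⟨⟨v, hv, rfl⟩, _⟩ ⟨⟨w, hw, h⟩, _⟩
    have := m1 v hv
    rw [Sym2.eq_iff] at h
    omega
  have hBcard : Bl.ncard = xb.length + yb.length := by
    rw [← c1, ← c2, ← Set.ncard_union_eq hdisj (hBfin.subset Set.inter_subset_right)
      (hBfin.subset Set.inter_subset_right), ← hBl2]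
  have hcfin : centralPathEdges.Finite := by
    unfold centralPathEdges; exact Set.toFinite _
  have hccard : centralPathEdges.ncard ≤ 5 := by
    unfold centralPathEdges
    refine (Set.ncard_insert_le _ _).trans (Nat.succ_le_succ ?_)
    refine (Set.ncard_insert_le _ _).trans (Nat.succ_le_succ ?_)
    refine (Set.ncard_insert_le _ _).trans (Nat.succ_le_succ ?_)
    refine (Set.ncard_insert_le _ _).trans (Nat.succ_le_succ ?_)
    rw [Set.ncard_singleton]
  have hunion : (centralPathEdges ∪ star 0 l1 ∪ star 1 l2) \ Bl ∪ Bl =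
      centralPathEdges ∪ star 0 l1 ∪ star 1 l2 := by
    refine Set.sdiff_union_of_subset (hBl.trans ?_)
    intro e he
    rcases he with h | h
    · exact Or.inl (Or.inr h)
    · exact Or.inr h
  have hcard : ((centralPathEdges ∪ star 0 l1 ∪ star 1 l2) \ Bl ∪ Bl).ncard ≤ 5 + p + q := by
    rw [hunion]
    have e1 := Set.ncard_union_le (centralPathEdges ∪ star 0 l1) (star 1 l2)
    have e2 := Set.ncard_union_le centralPathEdges (star 0 l1)
    rw [star_ncard _ n1, len1] at e2
    rw [star_ncard _ n2, len2] at e1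
    omega
  have hRfin : ((centralPathEdges ∪ star 0 l1 ∪ star 1 l2) \ Bl).Finite :=
    ((hcfin.union (star_finite _ _)).union (star_finite _ _)).sdiff
  have hcen : ∀ e ∈ centralPathEdges, e ∈ (centralPathEdges ∪ star 0 l1 ∪ star 1 l2) \ Bl := by
    intro e he
    refine ⟨Or.inl (Or.inl he), fun h => ?_⟩
    rcases hBl h with ⟨v, hv, rfl⟩ | ⟨v, hv, rfl⟩
    · have := m1 v hv
      simp only [centralPathEdges, Set.mem_insert_iff, Set.mem_singleton_iff, Sym2.eq_iff] at he
      omega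
    · have := m2 v hv
      simp only [centralPathEdges, Set.mem_insert_iff, Set.mem_singleton_iff, Sym2.eq_iff] at he
      omega
  have base : Base ((centralPathEdges ∪ star 0 l1 ∪ star 1 l2) \ Bl) xs ys := by
    refine ⟨hcen _ ?_, hcen _ ?_, hcen _ ?_, hcen _ ?_, hcen _ ?_, ?_, ?_, ?_⟩
    · simp [centralPathEdges]
    · simp [centralPathEdges]
    · simp [centralPathEdges]
    · simp [centralPathEdges]
    · simp [centralPathEdges]
    · intro x hx
      rw [hxs, List.mem_filter, decide_eq_true_eq] at hx
      exact ⟨(m1 x hx.1).1, Or.inl (Or.inr ⟨x, hx.1, rfl⟩), hx.2⟩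
    · intro x hx
      rw [hys, List.mem_filter, decide_eq_true_eq] at hx
      exact ⟨by have := m2 x hx.1; omega, Or.inr ⟨x, hx.1, rfl⟩, hx.2⟩
    · intro x hx y hy
      have h1 := m1 x (List.mem_filter.1 hx).1
      have h2 := m2 y (List.mem_filter.1 hy).1
      omega
  have nd : (0 :: 1 :: 2 :: 3 :: 4 :: 5 :: (xs ++ ys ++ xb ++ yb)).Nodup := by
    have hp : (0 :: 1 :: 2 :: 3 :: 4 :: 5 :: (xs ++ ys ++ xb ++ yb)).Perm
        (List.range' 0 6 ++ (l1 ++ l2)) := by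
      rw [List.perm_iff_count] at *
      intro c
      have e1 := px c
      have e2 := py c
      have e3 : List.range' 0 6 = [0, 1, 2, 3, 4, 5] := rfl
      rw [e3]
      simp only [List.count_cons, List.count_append, List.count_nil] at *
      omega
    rw [hp.nodup_iff, List.nodup_append, List.nodup_append]
    refine ⟨List.nodup_range', ⟨n1, n2, ?_⟩, ?_⟩
    · intro a ha b hb
      have := m1 a ha
      have := m2 b hb
      omega
    · intro a ha b hb
      rw [List.mem_range'_1] at ha
      rcases List.mem_append.1 hb with hb | hb
      · have := m1 b hb
        omega
      · have := m2 b hb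
        omega
  have hW := abstract_win (hc4.mono Set.sdiff_subset) base nd hred1 hred2 hblue1 hblue1' hblue2
    (by omega) (by omega)
  rw [hBE] at hW
  have hlen : 6 + xs.length + ys.length + xb.length + yb.length = 6 + p + q := by omega
  rw [hlen] at hW
  refine rrWin_of_WK hRfin hBfin (by omega) ((hW.toWK hBfin).2 _ ?_)
  omega

end OnlineRamsey
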